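/- Let L_+(A,B) be the cone of positive bounded linear maps from T(H_A) to T(H_B), equipped with the strong convergence topology. (A) A closed bounded subset L₀ ⊆ L_+(A,B) is compact in the strong convergence topology if there exists a faithful state σ ∈ S(H_A) such that { Φ(σ) : Φ ∈ L₀ } is a compact subset of T(H_B) in trace norm. (B) Conversely, if a subset L₀ ⊆ L_+(A,B) is compact in the strong convergence topology, then { Φ(σ) : Φ ∈ L₀ } is a compact subset of T(H_B) for every state σ ∈ S(H_A). -/

import Mathlib

open Filter Topology ContinuousLinearMap
open scoped ComplexOrder

noncomputable section

notation "⟪" x ", " y "⟫" => @inner ℂ _ _ x y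

section Defs

variable {H K : Type*} [NormedAddCommGroup H] [InnerProductSpace ℂ H] [CompleteSpace H]
  [NormedAddCommGroup K] [InnerProductSpace ℂ K] [CompleteSpace K]

/-- The rank-one operator `|y⟩⟨z|`. -/
def rankOne (y : K) (z : H) : H →L[ℂ] K :=
  (ContinuousLinearMap.toSpanSingleton ℂ y).comp (innerSL ℂ z)

/-- `A` is a trace-class operator (equivalently, nuclear operator). -/
def IsTC (A : H →L[ℂ] K) : Prop :=
  ∃ f : ℕ → K, ∃ g : ℕ → H, Summable (fun n => ‖f n‖ * ‖g n‖) ∧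
    ∀ x : H, HasSum (fun n => ⟪g n, x⟫ • f n) (A x)

/-- The trace of an operator, computed in a Hilbert basis. -/
def trC {ι : Type*} (e : HilbertBasis ι ℂ H) (A : H →L[ℂ] H) : ℂ :=
  ∑' i, ⟪e i, A (e i)⟫

/-- The trace norm `‖A‖₁ = sup {|Tr (B A)| : ‖B‖ ≤ 1}`. -/
def tnorm {ι : Type*} (e : HilbertBasis ι ℂ H) (A : H →L[ℂ] H) : ℝ :=
  sSup { r : ℝ | ∃ B : H →L[ℂ] H, ‖B‖ ≤ 1 ∧ r = ‖trC e (B ∘L A)‖ }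

/-- Membership in the positive cone `T₊(H)` of trace-class operators. -/
def IsPTC (ρ : H →L[ℂ] H) : Prop := ρ.IsPositive ∧ IsTC ρ

/-- `ρ` is a state (a positive trace-class operator of unit trace). -/
def IsState {ι : Type*} (e : HilbertBasis ι ℂ H) (ρ : H →L[ℂ] H) : Prop :=
  ρ.IsPositive ∧ IsTC ρ ∧ trC e ρ = 1

/-- `ρ` is a faithful state (a state with trivial kernel). -/
def IsFaithfulState {ι : Type*} (e : HilbertBasis ι ℂ H) (ρ : H →L[ℂ] H) : Prop :=
  IsState e ρ ∧ ∀ x, ρ x = 0 → x = 0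

/-- The Loewner operator order. -/
def OpLE (A B : H →L[ℂ] H) : Prop := (B - A).IsPositive

/-- `S` is the least upper bound of the sequence `A` in the Loewner order. -/
def IsLUBOp (A : ℕ → H →L[ℂ] H) (S : H →L[ℂ] H) : Prop :=
  (∀ m, OpLE (A m) S) ∧ ∀ C, (∀ m, OpLE (A m) C) → OpLE S C

/-- A quantum operation from `A` to `B`: a completely positive trace-non-increasing
linear map from `T(H_A)` to `T(H_B)`. -/
structure QOp (eA : HilbertBasis ℕ ℂ H) (eB : HilbertBasis ℕ ℂ K) where
  toFun : (H →L[ℂ] H) → (K →L[ℂ] K)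
  map_add' : ∀ ρ σ : H →L[ℂ] H, IsTC ρ → IsTC σ → toFun (ρ + σ) = toFun ρ + toFun σ
  map_smul' : ∀ (c : ℂ) (ρ : H →L[ℂ] H), IsTC ρ → toFun (c • ρ) = c • toFun ρ
  maps_tc' : ∀ ρ : H →L[ℂ] H, IsTC ρ → IsTC (toFun ρ)
  completely_pos' : ∀ (n : ℕ) (y : Fin n → H) (x : Fin n → K),
    0 ≤ ∑ i, ∑ j, ⟪x i, toFun (rankOne (y i) (y j)) (x j)⟫
  trace_nonincreasing' : ∀ ρ : H →L[ℂ] H, ρ.IsPositive → IsTC ρ →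
    (trC eB (toFun ρ)).re ≤ (trC eA ρ).re

variable {eA : HilbertBasis ℕ ℂ H} {eB : HilbertBasis ℕ ℂ K}

/-- A quantum channel is a trace-preserving quantum operation. -/
def IsChannel (Φ : QOp eA eB) : Prop :=
  ∀ ρ : H →L[ℂ] H, ρ.IsPositive → IsTC ρ → trC eB (Φ.toFun ρ) = trC eA ρ

/-- Convergence in the trace norm. -/
def TNConv {ι : Type*} (e : HilbertBasis ι ℂ K) (a : ℕ → K →L[ℂ] K) (L : K →L[ℂ] K) : Prop :=
  Tendsto (fun n => tnorm e (a n - L)) atTop (nhds 0)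

/-- Strong convergence of a sequence of quantum operations. -/
def StrongConv (Φn : ℕ → QOp eA eB) (Φ : QOp eA eB) : Prop :=
  ∀ ρ : H →L[ℂ] H, IsState eA ρ → TNConv eB (fun n => (Φn n).toFun ρ) (Φ.toFun ρ)

/-- Relative (sequential) compactness in the strong convergence topology. -/
def QRelCompact (F : Set (QOp eA eB)) : Prop :=
  ∀ Φs : ℕ → QOp eA eB, (∀ n, Φs n ∈ F) →
    ∃ (k : ℕ → ℕ) (Φ₀ : QOp eA eB), StrictMono k ∧ StrongConv (fun n => Φs (k n)) Φ₀

/-- Relative (sequential) compactness within the set of quantum channels. -/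
def QRelCompactCh (F : Set (QOp eA eB)) : Prop :=
  ∀ Φs : ℕ → QOp eA eB, (∀ n, Φs n ∈ F) →
    ∃ (k : ℕ → ℕ) (Φ₀ : QOp eA eB), StrictMono k ∧ IsChannel Φ₀ ∧
      StrongConv (fun n => Φs (k n)) Φ₀

/-- (Sequential) compactness in the strong convergence topology. -/
def QSeqCompact (F : Set (QOp eA eB)) : Prop :=
  ∀ Φs : ℕ → QOp eA eB, (∀ n, Φs n ∈ F) →
    ∃ (k : ℕ → ℕ) (Φ₀ : QOp eA eB), StrictMono k ∧ Φ₀ ∈ F ∧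
      StrongConv (fun n => Φs (k n)) Φ₀

/-- (Sequential) closedness in the strong convergence topology. -/
def QSeqClosed (F : Set (QOp eA eB)) : Prop :=
  ∀ (Φs : ℕ → QOp eA eB) (Φ₀ : QOp eA eB), (∀ n, Φs n ∈ F) → StrongConv Φs Φ₀ → Φ₀ ∈ F

/-- (Sequential) compactness of a set of operators in the trace norm. -/
def TNSeqCompact {ι : Type*} (e : HilbertBasis ι ℂ K) (S : Set (K →L[ℂ] K)) : Prop :=
  ∀ a : ℕ → K →L[ℂ] K, (∀ n, a n ∈ S) →
    ∃ (k : ℕ → ℕ) (L : K →L[ℂ] K), StrictMono k ∧ L ∈ S ∧ TNConv e (fun n => a (k n)) L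

/-- Relative (sequential) compactness of `S` within the ambient set `T`, in the trace norm. -/
def TNRelCompactIn {ι : Type*} (e : HilbertBasis ι ℂ K) (T S : Set (K →L[ℂ] K)) : Prop :=
  ∀ a : ℕ → K →L[ℂ] K, (∀ n, a n ∈ S) →
    ∃ (k : ℕ → ℕ) (L : K →L[ℂ] K), StrictMono k ∧ L ∈ T ∧ TNConv e (fun n => a (k n)) L

/-- `A` is a Kraus representation of `Φ`. -/
def KrausRep (Φ : QOp eA eB) (A : ℕ → H →L[ℂ] K) : Prop :=
  ∀ ρ : H →L[ℂ] H, IsTC ρ →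
    HasSum (fun n => A n ∘L ρ ∘L (ContinuousLinearMap.adjoint (A n))) (Φ.toFun ρ)

/-- The Choi rank of a quantum operation: the minimal number of Kraus operators. -/
def ChoiRank (Φ : QOp eA eB) : ℕ∞ :=
  sInf { n : ℕ∞ | ∃ A : ℕ → H →L[ℂ] K, (∀ i : ℕ, n ≤ (i : ℕ∞) → A i = 0) ∧ KrausRep Φ A }

/-- Convergence in the strong operator topology. -/
def SOTConv (a : ℕ → H →L[ℂ] K) (A : H →L[ℂ] K) : Prop :=
  ∀ x : H, Tendsto (fun n => a n x) atTop (nhds (A x))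

/-- Relative (sequential) compactness in the strong operator topology. -/
def SOTRelCompact (S : Set (H →L[ℂ] K)) : Prop :=
  ∀ a : ℕ → H →L[ℂ] K, (∀ n, a n ∈ S) →
    ∃ (k : ℕ → ℕ) (A : H →L[ℂ] K), StrictMono k ∧ SOTConv (fun n => a (k n)) A

/-- (Sequential) compactness in the strong operator topology. -/
def SOTSeqCompact (S : Set (H →L[ℂ] K)) : Prop :=
  ∀ a : ℕ → H →L[ℂ] K, (∀ n, a n ∈ S) →
    ∃ (k : ℕ → ℕ) (A : H →L[ℂ] K), StrictMono k ∧ A ∈ S ∧ SOTConv (fun n => a (k n)) A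

/-- A finite-rank orthogonal projection. -/
def IsFinRankProj (P : K →L[ℂ] K) : Prop :=
  IsSelfAdjoint P ∧ P ∘L P = P ∧ FiniteDimensional ℂ (LinearMap.range (P : K →ₗ[ℂ] K))

end Defs

section Tensor

variable {H K W : Type*} [NormedAddCommGroup H] [InnerProductSpace ℂ H] [CompleteSpace H]
  [NormedAddCommGroup K] [InnerProductSpace ℂ K] [CompleteSpace K]
  [NormedAddCommGroup W] [InnerProductSpace ℂ W] [CompleteSpace W]

/-- A realization of `W` as the Hilbert tensor product `H ⊗ K`. -/
structure TensorStruct (H K W : Type*) [NormedAddCommGroup H] [InnerProductSpace ℂ H]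
    [NormedAddCommGroup K] [InnerProductSpace ℂ K]
    [NormedAddCommGroup W] [InnerProductSpace ℂ W] where
  mul : H → K → W
  inner_mul : ∀ (x x' : H) (y y' : K), ⟪mul x y, mul x' y'⟫ = ⟪x, x'⟫ * ⟪y, y'⟫
  dense_span : Dense (↑(Submodule.span ℂ {w : W | ∃ x y, w = mul x y}) : Set W)

/-- `Z = X ⊗ Y` relative to the tensor realization `T`. -/
def IsTensorOp (T : TensorStruct H K W) (X : H →L[ℂ] H) (Y : K →L[ℂ] K)
    (Z : W →L[ℂ] W) : Prop :=
  ∀ x y, Z (T.mul x y) = T.mul (X x) (Y y)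

/-- `b = Tr_K ω`, the left partial trace, characterized by duality. -/
def IsLeftMarginal (T : TensorStruct H K W) {ι κ : Type*} (eH : HilbertBasis ι ℂ H)
    (eW : HilbertBasis κ ℂ W) (ω : W →L[ℂ] W) (b : H →L[ℂ] H) : Prop :=
  ∀ (X : H →L[ℂ] H) (Z : W →L[ℂ] W), IsTensorOp T X 1 Z →
    trC eH (b ∘L X) = trC eW (ω ∘L Z)

/-- `c = Tr_H ω`, the right partial trace, characterized by duality. -/
def IsRightMarginal (T : TensorStruct H K W) {ι κ : Type*} (eK : HilbertBasis ι ℂ K)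
    (eW : HilbertBasis κ ℂ W) (ω : W →L[ℂ] W) (c : K →L[ℂ] K) : Prop :=
  ∀ (Y : K →L[ℂ] K) (Z : W →L[ℂ] W), IsTensorOp T 1 Y Z →
    trC eK (c ∘L Y) = trC eW (ω ∘L Z)

end Tensor

section Statement

variable {HA HB : Type*} [NormedAddCommGroup HA] [InnerProductSpace ℂ HA] [CompleteSpace HA]
  [NormedAddCommGroup HB] [InnerProductSpace ℂ HB] [CompleteSpace HB]

/-- A positive bounded linear map from `T(H_A)` to `T(H_B)` (complete positivity is NOT
assumed). -/
structure PosMap (eA : HilbertBasis ℕ ℂ HA) (eB : HilbertBasis ℕ ℂ HB) where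
  toFun : (HA →L[ℂ] HA) → (HB →L[ℂ] HB)
  map_add' : ∀ ρ σ : HA →L[ℂ] HA, IsTC ρ → IsTC σ → toFun (ρ + σ) = toFun ρ + toFun σ
  map_smul' : ∀ (c : ℂ) (ρ : HA →L[ℂ] HA), IsTC ρ → toFun (c • ρ) = c • toFun ρ
  maps_tc' : ∀ ρ : HA →L[ℂ] HA, IsTC ρ → IsTC (toFun ρ)
  pos' : ∀ ρ : HA →L[ℂ] HA, ρ.IsPositive → IsTC ρ → (toFun ρ).IsPositive
  bdd' : ∃ C : ℝ, ∀ ρ : HA →L[ℂ] HA, IsState eA ρ → tnorm eB (toFun ρ) ≤ C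

variable {eA : HilbertBasis ℕ ℂ HA} {eB : HilbertBasis ℕ ℂ HB}

/-- Strong convergence of a sequence of positive maps. -/
def PStrongConv (Φn : ℕ → PosMap eA eB) (Φ : PosMap eA eB) : Prop :=
  ∀ ρ : HA →L[ℂ] HA, IsState eA ρ → TNConv eB (fun n => (Φn n).toFun ρ) (Φ.toFun ρ)

/-- (Sequential) compactness in the strong convergence topology on positive maps. -/
def PSeqCompact (L₀ : Set (PosMap eA eB)) : Prop :=
  ∀ Φs : ℕ → PosMap eA eB, (∀ n, Φs n ∈ L₀) →
    ∃ (k : ℕ → ℕ) (Φ₀ : PosMap eA eB), StrictMono k ∧ Φ₀ ∈ L₀ ∧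
      PStrongConv (fun n => Φs (k n)) Φ₀

/-- (Sequential) closedness in the strong convergence topology on positive maps. -/
def PSeqClosed (L₀ : Set (PosMap eA eB)) : Prop :=
  ∀ (Φs : ℕ → PosMap eA eB) (Φ₀ : PosMap eA eB),
    (∀ n, Φs n ∈ L₀) → PStrongConv Φs Φ₀ → Φ₀ ∈ L₀

section Nuclear

variable {H : Type*} [NormedAddCommGroup H] [InnerProductSpace ℂ H] {ι : Type*}

@[simp]
lemma rankOne_apply (y z x : H) : rankOne y z x = ⟪z, x⟫ • y := rfl

lemma norm_rankOne_le (y z : H) : ‖rankOne y z‖ ≤ ‖y‖ * ‖z‖ := by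
  refine ContinuousLinearMap.opNorm_le_bound _ (by positivity) fun x => ?_
  rw [rankOne_apply, norm_smul]
  calc ‖⟪z, x⟫‖ * ‖y‖ ≤ (‖z‖ * ‖x‖) * ‖y‖ := by gcongr; exact norm_inner_le_norm z x
    _ = ‖y‖ * ‖z‖ * ‖x‖ := by ring

/-- `A = ∑ |f n⟩⟨g n|` is a nuclear representation of `A`. -/
def NuclearRep (A : H →L[ℂ] H) (f g : ℕ → H) : Prop :=
  Summable (fun n => ‖f n‖ * ‖g n‖) ∧ ∀ x : H, HasSum (fun n => ⟪g n, x⟫ • f n) (A x)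

lemma NuclearRep.isTC {A : H →L[ℂ] H} {f g : ℕ → H} (h : NuclearRep A f g) : IsTC A :=
  ⟨f, g, h⟩

lemma IsTC.exists_nuclearRep {A : H →L[ℂ] H} (h : IsTC A) : ∃ f g, NuclearRep A f g := h

lemma NuclearRep.comp_left {A : H →L[ℂ] H} {f g : ℕ → H} (h : NuclearRep A f g)
    (B : H →L[ℂ] H) : NuclearRep (B ∘L A) (fun n => B (f n)) g := by
  refine ⟨Summable.of_nonneg_of_le (fun n => by positivity) (fun n => ?_) (h.1.mul_left ‖B‖),
    fun x => ?_⟩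
  · rw [← mul_assoc]
    gcongr
    exact B.le_opNorm _
  · simpa using (h.2 x).mapL B

lemma IsTC.comp_left {A : H →L[ℂ] H} (h : IsTC A) (B : H →L[ℂ] H) : IsTC (B ∘L A) := by
  obtain ⟨f, g, h⟩ := h.exists_nuclearRep
  exact (h.comp_left B).isTC

lemma IsTC.smul {A : H →L[ℂ] H} (h : IsTC A) (c : ℂ) : IsTC (c • A) := by
  have h1 : c • A = (c • ContinuousLinearMap.id ℂ H) ∘L A := by ext; simp
  exact h1 ▸ h.comp_left _

lemma IsTC.add {A B : H →L[ℂ] H} (hA : IsTC A) (hB : IsTC B) : IsTC (A + B) := by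
  obtain ⟨f, g, hf, hA⟩ := hA
  obtain ⟨f', g', hf', hB⟩ := hB
  refine ⟨fun n => if Even n then f (n / 2) else f' (n / 2),
    fun n => if Even n then g (n / 2) else g' (n / 2), ?_, fun x => ?_⟩
  · apply Summable.even_add_odd
    · simpa using hf
    · have h2 : ∀ k : ℕ, (2 * k + 1) / 2 = k := fun k => by omega
      simpa [h2] using hf'
  · apply HasSum.even_add_odd
    · simpa using hA x
    · have h2 : ∀ k : ℕ, (2 * k + 1) / 2 = k := fun k => by omega
      simpa [h2] using hB x

lemma IsTC.neg {A : H →L[ℂ] H} (hA : IsTC A) : IsTC (-A) := by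
  simpa using hA.smul (-1)

lemma IsTC.sub {A B : H →L[ℂ] H} (hA : IsTC A) (hB : IsTC B) : IsTC (A - B) := by
  simpa [sub_eq_add_neg] using hA.add hB.neg

lemma nuclearRep_rankOne (y z : H) :
    NuclearRep (rankOne y z) (fun n => if n = 0 then y else 0) (fun _ => z) := by
  refine ⟨summable_of_ne_finset_zero (s := {0}) fun n hn => ?_, fun x => ?_⟩
  · have : n ≠ 0 := by simpa using hn
    simp [this]
  · simpa only [smul_ite, smul_zero, rankOne_apply] using hasSum_ite_eq (0 : ℕ) (⟪z, x⟫ • y)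

lemma isTC_rankOne (y z : H) : IsTC (rankOne y z) := (nuclearRep_rankOne y z).isTC

lemma isTC_zero : IsTC (0 : H →L[ℂ] H) := by
  simpa using (isTC_rankOne (0 : H) 0).smul 0

lemma isTC_sum {α : Type*} (s : Finset α) (A : α → H →L[ℂ] H) (h : ∀ i ∈ s, IsTC (A i)) :
    IsTC (∑ i ∈ s, A i) :=
  Finset.sum_induction A IsTC (fun _ _ => IsTC.add) isTC_zero h

lemma NuclearRep.sub_sum {A : H →L[ℂ] H} {f g : ℕ → H} (h : NuclearRep A f g) (N : ℕ) :
    NuclearRep (A - ∑ n ∈ Finset.range N, rankOne (f n) (g n))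
      (fun n => f (n + N)) (fun n => g (n + N)) := by
  refine ⟨(summable_nat_add_iff N).2 h.1, fun x => ?_⟩
  simpa [_root_.sum_apply] using (hasSum_nat_add_iff' N).2 (h.2 x)

/-- The orthogonal projection onto the span of finitely many vectors of a Hilbert basis. -/
def finProj (e : HilbertBasis ι ℂ H) (s : Finset ι) : H →L[ℂ] H :=
  ∑ i ∈ s, rankOne (e i) (e i)

lemma finProj_apply (e : HilbertBasis ι ℂ H) (s : Finset ι) (x : H) :
    finProj e s x = ∑ i ∈ s, ⟪e i, x⟫ • e i := by
  simp [finProj]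

lemma inner_finProj_right (e : HilbertBasis ι ℂ H) (s : Finset ι) (x y : H) :
    ⟪x, finProj e s y⟫ = ∑ i ∈ s, ⟪x, e i⟫ * ⟪e i, y⟫ := by
  simp [finProj_apply, mul_comm]

lemma inner_finProj_left (e : HilbertBasis ι ℂ H) (s : Finset ι) (x y : H) :
    ⟪finProj e s x, y⟫ = ⟪x, finProj e s y⟫ := by
  rw [inner_finProj_right]
  simp [finProj_apply, mul_comm]

lemma norm_finProj_apply_le (e : HilbertBasis ι ℂ H) (s : Finset ι) (x : H) :
    ‖finProj e s x‖ ≤ ‖x‖ := by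
  have h : ‖finProj e s x‖ ^ 2 ≤ ‖x‖ ^ 2 := by
    have h2 := e.orthonormal.inner_sum (fun i => ⟪e i, x⟫) (fun i => ⟪e i, x⟫) s
    rw [← finProj_apply, inner_self_eq_norm_sq_to_K] at h2
    have h3 : ‖finProj e s x‖ ^ 2 = ∑ i ∈ s, ‖⟪e i, x⟫‖ ^ 2 := by
      simp only [Complex.conj_mul'] at h2
      apply Complex.ofReal_injective
      push_cast
      exact h2
    rw [h3]
    exact e.orthonormal.sum_inner_products_le x
  exact le_of_sq_le_sq h (norm_nonneg _)

lemma norm_finProj_le (e : HilbertBasis ι ℂ H) (s : Finset ι) : ‖finProj e s‖ ≤ 1 :=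
  ContinuousLinearMap.opNorm_le_bound _ zero_le_one fun x => by
    simpa using norm_finProj_apply_le e s x

lemma tendsto_finProj (e : HilbertBasis ι ℂ H) (x : H) :
    Tendsto (fun s => finProj e s x) atTop (𝓝 x) := by
  have := e.hasSum_repr x
  simp only [e.repr_apply_apply] at this
  simpa only [finProj_apply] using! this

lemma NuclearRep.sum_diag {A : H →L[ℂ] H} {f g : ℕ → H} (h : NuclearRep A f g)
    (e : HilbertBasis ι ℂ H) (s : Finset ι) :
    ∑ i ∈ s, ⟪e i, A (e i)⟫ = ∑' n, ⟪g n, finProj e s (f n)⟫ := by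
  simp_rw [inner_finProj_right]
  refine (HasSum.tsum_eq (hasSum_sum fun i _ => ?_)).symm
  simpa [inner_smul_right, Function.comp_def] using
    (h.2 (e i)).mapL (innerSL ℂ (e i))

lemma norm_inner_apply_le {x y : H} (B : H →L[ℂ] H) : ‖⟪y, B x⟫‖ ≤ ‖B‖ * (‖x‖ * ‖y‖) := by
  calc ‖⟪y, B x⟫‖ ≤ ‖y‖ * ‖B x‖ := norm_inner_le_norm _ _
    _ ≤ ‖y‖ * (‖B‖ * ‖x‖) := by gcongr; exact B.le_opNorm x
    _ = _ := by ring

lemma NuclearRep.summable_inner {A : H →L[ℂ] H} {f g : ℕ → H} (h : NuclearRep A f g)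
    (B : H →L[ℂ] H) : Summable (fun n => ⟪g n, B (f n)⟫) :=
  Summable.of_norm_bounded (h.1.mul_left ‖B‖) fun _ => norm_inner_apply_le B

lemma NuclearRep.hasSum_diag {A : H →L[ℂ] H} {f g : ℕ → H} (h : NuclearRep A f g)
    (e : HilbertBasis ι ℂ H) :
    HasSum (fun i => ⟪e i, A (e i)⟫) (∑' n, ⟪g n, f n⟫) := by
  simp only [HasSum, SummationFilter.unconditional_filter, h.sum_diag e]
  refine tendsto_tsum_of_dominated_convergence h.1
    (fun n => (tendsto_const_nhds).inner (tendsto_finProj e (f n)))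
    (Eventually.of_forall fun s n => ?_)
  calc _ ≤ ‖finProj e s‖ * (‖f n‖ * ‖g n‖) := norm_inner_apply_le _
    _ ≤ 1 * (‖f n‖ * ‖g n‖) := by gcongr; exact norm_finProj_le e s
    _ = _ := one_mul _

lemma NuclearRep.trC_comp {A : H →L[ℂ] H} {f g : ℕ → H} (h : NuclearRep A f g)
    (e : HilbertBasis ι ℂ H) (B : H →L[ℂ] H) :
    trC e (B ∘L A) = ∑' n, ⟪g n, B (f n)⟫ :=
  ((h.comp_left B).hasSum_diag e).tsum_eq

lemma NuclearRep.norm_trC_comp_le {A : H →L[ℂ] H} {f g : ℕ → H} (h : NuclearRep A f g)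
    (e : HilbertBasis ι ℂ H) (B : H →L[ℂ] H) :
    ‖trC e (B ∘L A)‖ ≤ (∑' n, ‖f n‖ * ‖g n‖) * ‖B‖ := by
  rw [h.trC_comp, mul_comm, ← tsum_mul_left]
  exact tsum_of_norm_bounded (h.1.mul_left ‖B‖).hasSum fun _ => norm_inner_apply_le B

lemma IsTC.exists_linear_bound {A : H →L[ℂ] H} (h : IsTC A) (e : HilbertBasis ι ℂ H) :
    ∃ T : (H →L[ℂ] H) →L[ℂ] ℂ, ∀ B, T B = trC e (B ∘L A) := by
  obtain ⟨f, g, h⟩ := h.exists_nuclearRep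
  refine ⟨LinearMap.mkContinuous
    { toFun := fun B => trC e (B ∘L A)
      map_add' := fun B C => ?_
      map_smul' := fun c B => ?_ } (∑' n, ‖f n‖ * ‖g n‖) (fun B => h.norm_trC_comp_le e B),
    fun B => rfl⟩
  · simp_rw [h.trC_comp, _root_.add_apply, inner_add_right]
    exact (h.summable_inner B).tsum_add (h.summable_inner C)
  · simp_rw [h.trC_comp, _root_.smul_apply, inner_smul_right, tsum_mul_left]
    rfl

open Classical in
/-- The functional `B ↦ Tr (B A)` on bounded operators, for a trace-class operator `A`. -/
def traceFun (e : HilbertBasis ι ℂ H) (A : H →L[ℂ] H) : (H →L[ℂ] H) →L[ℂ] ℂ :=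
  if h : IsTC A then (h.exists_linear_bound e).choose else 0

variable {e : HilbertBasis ι ℂ H} {A A' : H →L[ℂ] H} {f g : ℕ → H}

lemma traceFun_apply (h : IsTC A) (B : H →L[ℂ] H) : traceFun e A B = trC e (B ∘L A) := by
  rw [traceFun, dif_pos h]
  exact (h.exists_linear_bound e).choose_spec B

lemma NuclearRep.traceFun_apply (h : NuclearRep A f g) (B : H →L[ℂ] H) :
    traceFun e A B = ∑' n, ⟪g n, B (f n)⟫ := by
  rw [_root_.traceFun_apply h.isTC, h.trC_comp]

lemma hasSum_traceFun (h : IsTC A) (B : H →L[ℂ] H) :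
    HasSum (fun i => ⟪e i, B (A (e i))⟫) (traceFun e A B) := by
  obtain ⟨f, g, h⟩ := h.exists_nuclearRep
  rw [h.traceFun_apply]
  exact (h.comp_left B).hasSum_diag e

lemma traceFun_one (h : IsTC A) : traceFun e A 1 = trC e A :=
  (traceFun_apply h 1).trans rfl

lemma traceFun_add (h : IsTC A) (h' : IsTC A') :
    traceFun e (A + A') = traceFun e A + traceFun e A' := by
  ext B
  refine (hasSum_traceFun (h.add h') B).unique ?_
  simpa [inner_add_right] using (hasSum_traceFun h B).add (hasSum_traceFun h' B)

lemma traceFun_smul (h : IsTC A) (c : ℂ) : traceFun e (c • A) = c • traceFun e A := by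
  ext B
  refine (hasSum_traceFun (h.smul c) B).unique ?_
  simpa [inner_smul_right] using (hasSum_traceFun h B).mul_left c

lemma traceFun_sub (h : IsTC A) (h' : IsTC A') :
    traceFun e (A - A') = traceFun e A - traceFun e A' := by
  ext B
  refine (hasSum_traceFun (h.sub h') B).unique ?_
  simpa [inner_sub_right] using (hasSum_traceFun h B).sub (hasSum_traceFun h' B)

lemma tnorm_eq_norm_traceFun (h : IsTC A) : tnorm e A = ‖traceFun e A‖ := by
  rw [← ContinuousLinearMap.sSup_unitClosedBall_eq_norm, tnorm]
  congr 1
  ext r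
  simp [traceFun_apply h, eq_comm]

lemma traceFun_rankOne (h : IsTC A) (x y : H) : traceFun e A (rankOne y x) = ⟪x, A y⟫ := by
  obtain ⟨f, g, h⟩ := h.exists_nuclearRep
  rw [h.traceFun_apply]
  refine HasSum.tsum_eq ?_
  simpa [inner_smul_right, mul_comm, Function.comp_def] using (h.2 y).mapL (innerSL ℂ x)

lemma norm_inner_le_traceFun (h : IsTC A) (x y : H) :
    ‖⟪x, A y⟫‖ ≤ ‖traceFun e A‖ * (‖x‖ * ‖y‖) := by
  rw [← traceFun_rankOne (e := e) h]
  refine (ContinuousLinearMap.le_opNorm _ _).trans ?_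
  gcongr
  rw [mul_comm]
  exact norm_rankOne_le y x

lemma norm_le_traceFun (h : IsTC A) : ‖A‖ ≤ ‖traceFun e A‖ := by
  refine ContinuousLinearMap.opNorm_le_bound _ (traceFun e A).opNorm_nonneg fun y => ?_
  have h1 := norm_inner_le_traceFun (e := e) h (A y) y
  rw [inner_self_eq_norm_sq_to_K] at h1
  simp only [norm_pow, RCLike.norm_ofReal, abs_norm] at h1
  by_cases h0 : ‖A y‖ = 0
  · rw [h0]; positivity
  · have hp : 0 < ‖A y‖ := lt_of_le_of_ne (norm_nonneg _) (Ne.symm h0)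
    refine le_of_mul_le_mul_right ?_ hp
    nlinarith

lemma traceFun_finProj_comp (h : IsTC A) (s : Finset ι) (B : H →L[ℂ] H) :
    traceFun e A (finProj e s ∘L B) = ∑ i ∈ s, ⟪e i, B (A (e i))⟫ := by
  obtain ⟨f, g, h⟩ := h.exists_nuclearRep
  rw [h.traceFun_apply]
  exact ((h.comp_left B).sum_diag e s).symm

lemma norm_sum_diag_le (h : IsTC A) (s : Finset ι) :
    ‖∑ i ∈ s, ⟪e i, A (e i)⟫‖ ≤ ‖traceFun e A‖ := by
  have := traceFun_finProj_comp (e := e) h s (ContinuousLinearMap.id ℂ H)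
  simp only [ContinuousLinearMap.comp_id, ContinuousLinearMap.id_apply] at this
  rw [← this]
  refine (ContinuousLinearMap.le_opNorm _ _).trans ?_
  exact mul_le_of_le_one_right (norm_nonneg _) (norm_finProj_le e s)

lemma finProj_finProj (s : Finset ι) (x : H) : finProj e s (finProj e s x) = finProj e s x := by
  conv_rhs => rw [finProj_apply]
  rw [finProj_apply]
  refine Finset.sum_congr rfl fun i hi => ?_
  congr 1
  rw [finProj_apply, e.orthonormal.inner_right_sum _ hi]

lemma inner_sub_finProj (s : Finset ι) (x : H) :
    ⟪x, x - finProj e s x⟫ = ((‖x - finProj e s x‖ ^ 2 : ℝ) : ℂ) := by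
  have h : ⟪finProj e s x, x - finProj e s x⟫ = 0 := by
    rw [inner_finProj_left, map_sub, finProj_finProj, sub_self, inner_zero_right]
  have h2 : ⟪x - finProj e s x, x - finProj e s x⟫ = ⟪x, x - finProj e s x⟫ := by
    rw [inner_sub_left, h, sub_zero]
  rw [← h2, inner_self_eq_norm_sq_to_K]
  norm_cast

variable {a : ℕ → H}

lemma NuclearRep.traceFun_one_self (h : NuclearRep A a a) :
    traceFun e A 1 = ((∑' n, ‖a n‖ ^ 2 : ℝ) : ℂ) := by
  rw [h.traceFun_apply, Complex.ofReal_tsum]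
  refine tsum_congr fun n => ?_
  rw [_root_.one_apply_eq_self, inner_self_eq_norm_sq_to_K]
  norm_cast

lemma NuclearRep.traceFun_one_sub_finProj (h : NuclearRep A a a) (s : Finset ι) :
    traceFun e A (1 - finProj e s) = ((∑' n, ‖a n - finProj e s (a n)‖ ^ 2 : ℝ) : ℂ) := by
  rw [h.traceFun_apply, Complex.ofReal_tsum]
  exact tsum_congr fun n => inner_sub_finProj s (a n)

lemma NuclearRep.summable_sq (h : NuclearRep A a a) : Summable fun n => ‖a n‖ ^ 2 := by
  simpa only [sq] using h.1

lemma NuclearRep.summable_sub_finProj_sq (h : NuclearRep A a a) (s : Finset ι) :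
    Summable fun n => ‖a n - finProj e s (a n)‖ ^ 2 := by
  refine Summable.of_nonneg_of_le (fun n => by positivity) (fun n => ?_) (h.summable_sq.mul_left 4)
  have h1 := norm_sub_le (a n) (finProj e s (a n))
  have h2 := norm_finProj_apply_le e s (a n)
  nlinarith [norm_nonneg (a n - finProj e s (a n)), norm_nonneg (a n)]

/-- Compressing by a finite projection changes `Tr (B A)` by a quantity controlled by the tail
of the trace of the positive operator `A`. -/
lemma NuclearRep.norm_traceFun_sub_compress_le (h : NuclearRep A a a) (s : Finset ι)
    (B : H →L[ℂ] H) {δ : ℝ} (hδ : 0 < δ) :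
    ‖traceFun e A (B - finProj e s ∘L B ∘L finProj e s)‖ ≤
      (δ * (traceFun e A 1).re + δ⁻¹ * (traceFun e A (1 - finProj e s)).re) * ‖B‖ := by
  rw [h.traceFun_apply, h.traceFun_one_self, h.traceFun_one_sub_finProj, Complex.ofReal_re,
    Complex.ofReal_re]
  refine tsum_of_norm_bounded (((h.summable_sq.hasSum.mul_left δ).add
    ((h.summable_sub_finProj_sq s).hasSum.mul_left δ⁻¹)).mul_right ‖B‖) fun n => ?_
  set x := a n
  set P := finProj e s
  have h1 : ⟪x, (B - P ∘L B ∘L P) x⟫ = ⟪x, B (x - P x)⟫ + ⟪x - P x, B (P x)⟫ := by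
    simp only [_root_.sub_apply, ContinuousLinearMap.comp_apply, inner_sub_right, map_sub,
      inner_sub_left, P, inner_finProj_left]
    ring
  have h2 : ‖P x‖ ≤ ‖x‖ := norm_finProj_apply_le e s x
  have h3 : 2 * ‖x‖ * ‖x - P x‖ ≤ δ * ‖x‖ ^ 2 + δ⁻¹ * ‖x - P x‖ ^ 2 := by
    have h4 : δ * ‖x‖ ^ 2 + δ⁻¹ * ‖x - P x‖ ^ 2 - 2 * ‖x‖ * ‖x - P x‖ =
        δ⁻¹ * (δ * ‖x‖ - ‖x - P x‖) ^ 2 := by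
      field_simp
      ring
    have h5 : 0 ≤ δ⁻¹ * (δ * ‖x‖ - ‖x - P x‖) ^ 2 := by positivity
    linarith
  calc ‖⟪x, (B - P ∘L B ∘L P) x⟫‖
      ≤ ‖⟪x, B (x - P x)⟫‖ + ‖⟪x - P x, B (P x)⟫‖ := h1 ▸ norm_add_le _ _
    _ ≤ ‖B‖ * (‖x - P x‖ * ‖x‖) + ‖B‖ * (‖P x‖ * ‖x - P x‖) :=
      add_le_add (norm_inner_apply_le B) (norm_inner_apply_le B)
    _ ≤ ‖B‖ * (‖x - P x‖ * ‖x‖) + ‖B‖ * (‖x‖ * ‖x - P x‖) := by gcongr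
    _ = (2 * ‖x‖ * ‖x - P x‖) * ‖B‖ := by ring
    _ ≤ _ := by gcongr

lemma norm_traceFun_compress_le (h : IsTC A) (s : Finset ι) (B : H →L[ℂ] H) :
    ‖traceFun e A (finProj e s ∘L B ∘L finProj e s)‖ ≤
      (∑ i ∈ s, ∑ j ∈ s, ‖⟪e j, A (e i)⟫‖) * ‖B‖ := by
  rw [traceFun_finProj_comp h, Finset.sum_mul]
  refine (norm_sum_le _ _).trans (Finset.sum_le_sum fun i _ => ?_)
  rw [ContinuousLinearMap.comp_apply, finProj_apply, map_sum, inner_sum, Finset.sum_mul]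
  refine (norm_sum_le _ _).trans (Finset.sum_le_sum fun j _ => ?_)
  rw [map_smul, inner_smul_right, norm_mul]
  gcongr
  simpa [e.orthonormal.norm_eq_one] using norm_inner_apply_le (x := e j) (y := e i) B

lemma tendsto_traceFun_one_sub_finProj (h : IsTC A) :
    Tendsto (fun s => traceFun e A (1 - finProj e s)) atTop (𝓝 0) := by
  have h1 : ∀ s, traceFun e A (finProj e s) = ∑ i ∈ s, ⟪e i, A (e i)⟫ := fun s => by
    simpa using traceFun_finProj_comp (e := e) h s (ContinuousLinearMap.id ℂ H)
  simp only [map_sub, h1]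
  rw [← sub_self (traceFun e A 1)]
  exact tendsto_const_nhds.sub (hasSum_traceFun h 1)

lemma isPositive_iff_inner_nonneg : A.IsPositive ↔ ∀ x, (0 : ℂ) ≤ ⟪x, A x⟫ := by
  refine ⟨fun h x => h.inner_nonneg_right x, fun h => ?_⟩
  rw [ContinuousLinearMap.isPositive_iff_complex]
  intro x
  have h1 := h x
  rw [Complex.le_def] at h1
  rw [← inner_conj_symm]
  have h2 : 0 ≤ (⟪x, A x⟫).re := h1.1
  have h3 : 0 = (⟪x, A x⟫).im := h1.2
  refine ⟨Complex.ext rfl ?_, h2⟩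
  rw [Complex.conj_im, ← h3]
  simp

lemma isPositive_of_tendsto {A : ℕ → H →L[ℂ] H} {L : H →L[ℂ] H} (hA : ∀ n, (A n).IsPositive)
    (hL : Tendsto A atTop (𝓝 L)) : L.IsPositive := by
  rw [isPositive_iff_inner_nonneg]
  intro x
  have h : Tendsto (fun n => ⟪x, A n x⟫) atTop (𝓝 ⟪x, L x⟫) :=
    tendsto_const_nhds.inner (((ContinuousLinearMap.apply ℂ H x).continuous.tendsto L).comp hL)
  exact ge_of_tendsto' h fun n => isPositive_iff_inner_nonneg.1 (hA n) x

end Nuclear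

section Positive

variable {H : Type*} [NormedAddCommGroup H] [InnerProductSpace ℂ H] [CompleteSpace H] {ι : Type*}
  {e : HilbertBasis ι ℂ H} {A A' : H →L[ℂ] H}

lemma exists_selfAdjoint_sqrt (hA : A.IsPositive) :
    ∃ S : H →L[ℂ] H, (∀ x y, ⟪S x, y⟫ = ⟪x, S y⟫) ∧ ∀ x, S (S x) = A x := by
  have h0 : 0 ≤ A := (ContinuousLinearMap.nonneg_iff_isPositive A).2 hA
  refine ⟨CFC.sqrt A, fun x y => ?_, fun x => ?_⟩
  · exact ((ContinuousLinearMap.nonneg_iff_isPositive _).1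
      (CFC.sqrt_nonneg A)).inner_left_eq_inner_right x y
  · exact congrArg (fun T : H →L[ℂ] H => T x) (CFC.sqrt_mul_sqrt_self A h0)

lemma norm_inner_sq_le_of_isPositive (hA : A.IsPositive) (x y : H) :
    ‖⟪x, A y⟫‖ ^ 2 ≤ (⟪x, A x⟫).re * (⟪y, A y⟫).re := by
  obtain ⟨S, hS, hSA⟩ := exists_selfAdjoint_sqrt hA
  have h : ∀ x y, ⟪x, A y⟫ = ⟪S x, S y⟫ := fun x y => by rw [hS, hSA]
  have h2 : ∀ x, (⟪x, A x⟫).re = ‖S x‖ ^ 2 := fun x => by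
    rw [h, inner_self_eq_norm_sq_to_K]
    norm_cast
  rw [h2, h2, h, ← mul_pow]
  gcongr
  exact norm_inner_le_norm _ _

/-- A positive operator with bounded diagonal sums admits a symmetric nuclear representation. -/
lemma exists_nuclearRep_of_isPositive (e : HilbertBasis ℕ ℂ H) (hA : A.IsPositive) {C : ℝ}
    (hC : ∀ s : Finset ℕ, ‖∑ i ∈ s, ⟪e i, A (e i)⟫‖ ≤ C) : ∃ a, NuclearRep A a a := by
  obtain ⟨S, hS, hSA⟩ := exists_selfAdjoint_sqrt hA
  refine ⟨fun n => S (e n), summable_of_sum_le (c := C) (fun n => by positivity) fun s => ?_,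
    fun x => ?_⟩
  · refine le_trans (le_of_eq ?_) (hC s)
    have : ∑ i ∈ s, ⟪e i, A (e i)⟫ = ((∑ i ∈ s, ‖S (e i)‖ * ‖S (e i)‖ : ℝ) : ℂ) := by
      push_cast
      refine Finset.sum_congr rfl fun i _ => ?_
      rw [← hSA, ← hS, inner_self_eq_norm_sq_to_K, sq]
      rfl
    rw [this, Complex.norm_real, Real.norm_of_nonneg]
    exact Finset.sum_nonneg fun i _ => by positivity
  · have := (e.hasSum_repr (S x)).mapL S
    simpa only [e.repr_apply_apply, map_smul, hSA, hS] using! this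

lemma exists_symmetric_nuclearRep (e : HilbertBasis ℕ ℂ H) (hA : A.IsPositive) (h : IsTC A) :
    ∃ a, NuclearRep A a a :=
  exists_nuclearRep_of_isPositive e hA fun s => norm_sum_diag_le (e := e) h s

lemma traceFun_one_sub_finProj_nonneg {e : HilbertBasis ℕ ℂ H} (hA : A.IsPositive) (h : IsTC A)
    (s : Finset ℕ) : 0 ≤ (traceFun e A (1 - finProj e s)).re := by
  obtain ⟨a, ha⟩ := exists_symmetric_nuclearRep e hA h
  rw [ha.traceFun_one_sub_finProj, Complex.ofReal_re]
  exact tsum_nonneg fun n => by positivity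

/-- A sequence of positive trace-class operators whose matrix elements are Cauchy and whose traces
have uniformly small tails is Cauchy in the trace norm. -/
lemma cauchySeq_traceFun_of_tails {e : HilbertBasis ℕ ℂ H} {A : ℕ → H →L[ℂ] H}
    (hpos : ∀ n, (A n).IsPositive) (htc : ∀ n, IsTC (A n)) {C : ℝ}
    (hC : ∀ n, ‖traceFun e (A n)‖ ≤ C) (hmat : ∀ i j, CauchySeq fun n => ⟪e i, A n (e j)⟫)
    (htail : ∀ ε > 0, ∃ s : Finset ℕ, ∀ᶠ n in atTop,
      (traceFun e (A n) (1 - finProj e s)).re ≤ ε) :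
    CauchySeq fun n => traceFun e (A n) := by
  rw [Metric.cauchySeq_iff]
  intro ε hε
  have hC0 : 0 ≤ C := (norm_nonneg _).trans (hC 0)
  set δ : ℝ := ε / (8 * (C + 1)) with hδ
  have hδ0 : 0 < δ := by positivity
  obtain ⟨s, hs⟩ := htail (δ * (ε / 8)) (by positivity)
  have hfin : ∀ᶠ p : ℕ × ℕ in atTop,
      ∑ i ∈ s, ∑ j ∈ s, ‖⟪e j, (A p.1 - A p.2) (e i)⟫‖ < ε / 4 := by
    have ht : Tendsto (fun p : ℕ × ℕ => ∑ i ∈ s, ∑ j ∈ s, ‖⟪e j, (A p.1 - A p.2) (e i)⟫‖)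
        atTop (𝓝 (∑ i ∈ s, ∑ j ∈ s, 0)) := by
      refine tendsto_finsetSum _ fun i _ => tendsto_finsetSum _ fun j _ => ?_
      have := cauchySeq_iff_tendsto_dist_atTop_0.1 (hmat j i)
      simpa [dist_eq_norm, inner_sub_right] using this
    simp only [Finset.sum_const_zero] at ht
    exact ht.eventually (gt_mem_nhds (by positivity))
  obtain ⟨N₁, hN₁⟩ := eventually_atTop_prod_self.1 hfin
  obtain ⟨N₂, hN₂⟩ := eventually_atTop.1 hs
  have hcomp : ∀ n ≥ N₂, ∀ B, ‖traceFun e (A n) (B - finProj e s ∘L B ∘L finProj e s)‖ ≤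
      ε / 4 * ‖B‖ := by
    intro n hn B
    obtain ⟨a, ha⟩ := exists_symmetric_nuclearRep e (hpos n) (htc n)
    refine (ha.norm_traceFun_sub_compress_le s B hδ0).trans ?_
    gcongr
    have h1 : (traceFun e (A n) 1).re ≤ C := by
      refine (Complex.re_le_norm _).trans (((traceFun e (A n)).le_opNorm 1).trans ?_)
      refine le_trans ?_ (hC n)
      exact mul_le_of_le_one_right (norm_nonneg _) ContinuousLinearMap.norm_id_le
    have h2 : δ⁻¹ * (traceFun e (A n) (1 - finProj e s)).re ≤ ε / 8 := by
      rw [inv_mul_le_iff₀ hδ0]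
      exact hN₂ n hn
    have h3 : δ * (traceFun e (A n) 1).re ≤ ε / 8 := by
      calc δ * (traceFun e (A n) 1).re ≤ δ * (C + 1) := by gcongr; linarith
        _ = ε / 8 := by rw [hδ]; field_simp
    linarith
  refine ⟨max N₁ N₂, fun m hm n hn => ?_⟩
  rw [dist_eq_norm, ← traceFun_sub (htc m) (htc n)]
  refine lt_of_le_of_lt (ContinuousLinearMap.opNorm_le_bound _ (M := 3 * ε / 4) (by positivity)
    fun B => ?_) (by linarith)
  have h1 := hcomp m (le_of_max_le_right hm) B
  have h2 := hcomp n (le_of_max_le_right hn) B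
  have h3 := norm_traceFun_compress_le (e := e) ((htc m).sub (htc n)) s B
  have h4 : (∑ i ∈ s, ∑ j ∈ s, ‖⟪e j, (A m - A n) (e i)⟫‖) * ‖B‖ ≤ ε / 4 * ‖B‖ := by
    gcongr
    exact (hN₁ m n (le_of_max_le_left hm) (le_of_max_le_left hn)).le
  set D := finProj e s ∘L B ∘L finProj e s
  have h5 : traceFun e (A m - A n) B = traceFun e (A m) (B - D) - traceFun e (A n) (B - D) +
      traceFun e (A m - A n) D := by
    rw [traceFun_sub (htc m) (htc n)]
    simp only [map_sub, _root_.sub_apply]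
    ring
  rw [h5]
  calc _ ≤ _ := norm_add_le _ _
    _ ≤ (‖traceFun e (A m) (B - D)‖ + ‖traceFun e (A n) (B - D)‖) + _ :=
      add_le_add_left (norm_sub_le _ _) _
    _ ≤ _ := by linarith

/-- A sequence which is Cauchy in the trace norm and converges in the operator norm to a trace-class
operator converges in the trace norm. -/
lemma tendsto_traceFun_of_cauchySeq {A : ℕ → H →L[ℂ] H} {L : H →L[ℂ] H}
    (htc : ∀ n, IsTC (A n)) (hc : CauchySeq fun n => traceFun e (A n))
    (hA : Tendsto A atTop (𝓝 L)) (hL : IsTC L) :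
    Tendsto (fun n => traceFun e (A n)) atTop (𝓝 (traceFun e L)) := by
  rw [Metric.tendsto_atTop]
  intro ε hε
  obtain ⟨N, hN⟩ := Metric.cauchySeq_iff.1 hc (ε / 2) (by positivity)
  refine ⟨N, fun n hn => ?_⟩
  rw [dist_eq_norm, ← traceFun_sub (htc n) hL]
  refine lt_of_le_of_lt (ContinuousLinearMap.opNorm_le_bound _ (M := ε / 2) (by positivity)
    fun B => ?_) (by linarith)
  refine le_of_tendsto (hasSum_traceFun ((htc n).sub hL) B).norm (Eventually.of_forall fun s => ?_)
  have ht : Tendsto (fun m => ‖∑ i ∈ s, ⟪e i, B ((A n - A m) (e i))⟫‖) atTop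
      (𝓝 ‖∑ i ∈ s, ⟪e i, B ((A n - L) (e i))⟫‖) := by
    refine (tendsto_finsetSum _ fun i _ => ?_).norm
    refine tendsto_const_nhds.inner ((B.continuous.tendsto _).comp ?_)
    exact ((ContinuousLinearMap.apply ℂ H (e i)).continuous.tendsto _).comp
      (tendsto_const_nhds.sub hA)
  refine le_of_tendsto ht (eventually_atTop.2 ⟨N, fun m hm => ?_⟩)
  rw [← traceFun_finProj_comp ((htc n).sub (htc m))]
  refine (ContinuousLinearMap.le_opNorm _ _).trans ?_
  have h1 := hN n hn m hm
  rw [dist_eq_norm, ← traceFun_sub (htc n) (htc m)] at h1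
  refine mul_le_mul h1.le ?_ (norm_nonneg _) (by positivity)
  refine (ContinuousLinearMap.opNorm_comp_le _ _).trans ?_
  exact mul_le_of_le_one_left (norm_nonneg _) (norm_finProj_le e s)

end Positive

section Decomposition

variable {H : Type*} [NormedAddCommGroup H] [InnerProductSpace ℂ H]

lemma exists_balanced_pair (f g : H) : ∃ f' g' : H, (∀ x, ⟪g', x⟫ • f' = ⟪g, x⟫ • f) ∧
    ‖f'‖ ^ 2 = ‖f‖ * ‖g‖ ∧ ‖g'‖ ^ 2 = ‖f‖ * ‖g‖ := by
  by_cases hf : f = 0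
  · exact ⟨0, 0, by simp [hf]⟩
  by_cases hg : g = 0
  · exact ⟨0, 0, by simp [hg]⟩
  have hf' : 0 < ‖f‖ := norm_pos_iff.2 hf
  have hg' : 0 < ‖g‖ := norm_pos_iff.2 hg
  set t : ℝ := √(‖g‖ / ‖f‖) with ht
  have ht0 : 0 < t := Real.sqrt_pos.2 (by positivity)
  have ht2 : t ^ 2 = ‖g‖ / ‖f‖ := Real.sq_sqrt (by positivity)
  refine ⟨(t : ℂ) • f, ((t⁻¹ : ℝ) : ℂ) • g, fun x => ?_, ?_, ?_⟩
  · rw [inner_smul_left, smul_smul, Complex.conj_ofReal]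
    congr 1
    have : (t : ℂ) ≠ 0 := by exact_mod_cast ht0.ne'
    push_cast
    field_simp
  · rw [norm_smul, Complex.norm_real, Real.norm_of_nonneg ht0.le, mul_pow, ht2]
    field_simp
  · rw [norm_smul, Complex.norm_real, Real.norm_of_nonneg (by positivity), mul_pow, inv_pow, ht2]
    field_simp

lemma polarization_rankOne (f g x : H) :
    ∑ l : Fin 4, ((1 / 4 : ℂ) * Complex.I ^ (l : ℕ)) •
      (⟪f + Complex.I ^ (l : ℕ) • g, x⟫ • (f + Complex.I ^ (l : ℕ) • g)) = ⟪g, x⟫ • f := by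
  have h3 : Complex.I ^ 3 = -Complex.I := Complex.I_pow_three
  simp only [Fin.sum_univ_four, Fin.val_zero, Fin.val_one, Fin.val_two, pow_zero, pow_one,
    show ((3 : Fin 4) : ℕ) = 3 from rfl, Complex.I_sq, h3, inner_add_left, inner_smul_left,
    map_neg, map_one, Complex.conj_I]
  match_scalars
  · linear_combination (-⟪g, x⟫ / 2) * Complex.I_sq
  · linear_combination (1 / 2 * ⟪f, x⟫) * Complex.I_sq

variable [CompleteSpace H] {A : H →L[ℂ] H}

lemma exists_isPositive_nuclearRep {a : ℕ → H} (h : Summable fun n => ‖a n‖ ^ 2) :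
    ∃ R : H →L[ℂ] H, R.IsPositive ∧ NuclearRep R a a := by
  have hs : Summable fun n => rankOne (a n) (a n) :=
    Summable.of_norm_bounded h fun n => (norm_rankOne_le _ _).trans_eq (sq _).symm
  have hR : NuclearRep (∑' n, rankOne (a n) (a n)) a a := by
    refine ⟨by simpa only [sq] using h, fun x => ?_⟩
    exact hs.hasSum.mapL (ContinuousLinearMap.apply ℂ H x)
  refine ⟨_, isPositive_iff_inner_nonneg.2 fun x => ?_, hR⟩
  refine ((hR.2 x).mapL (innerSL ℂ x)).nonneg fun n => ?_
  simp only [innerSL_apply_apply, inner_smul_right]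
  rw [← inner_conj_symm, Complex.conj_mul']
  exact_mod_cast sq_nonneg ‖⟪x, a n⟫‖

/-- Every trace-class operator is a combination of four positive trace-class operators, with control
of the traces. -/
lemma NuclearRep.exists_positive_decomposition {f g : ℕ → H} (h : NuclearRep A f g) :
    ∃ (R : Fin 4 → H →L[ℂ] H) (a : Fin 4 → ℕ → H),
      (∀ l, (R l).IsPositive ∧ NuclearRep (R l) (a l) (a l) ∧
        ∑' n, ‖a l n‖ ^ 2 ≤ 4 * ∑' n, ‖f n‖ * ‖g n‖) ∧
      A = ∑ l : Fin 4, ((1 / 4 : ℂ) * Complex.I ^ (l : ℕ)) • R l := by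
  choose f' g' hfg hf hg using fun n => exists_balanced_pair (f n) (g n)
  set a : Fin 4 → ℕ → H := fun l n => f' n + Complex.I ^ (l : ℕ) • g' n with ha
  have hle : ∀ l n, ‖a l n‖ ^ 2 ≤ 4 * (‖f n‖ * ‖g n‖) := fun l n => by
    have h1 : ‖a l n‖ ≤ ‖f' n‖ + ‖g' n‖ := by
      refine (norm_add_le _ _).trans_eq ?_
      simp [norm_smul]
    have h2 := hf n
    have h3 := hg n
    nlinarith [norm_nonneg (a l n), sq_nonneg (‖f' n‖ - ‖g' n‖)]
  have hs : ∀ l, Summable fun n => ‖a l n‖ ^ 2 := fun l =>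
    Summable.of_nonneg_of_le (fun n => by positivity) (hle l) (h.1.mul_left 4)
  choose R hR hRa using fun l => exists_isPositive_nuclearRep (hs l)
  refine ⟨R, a, fun l => ⟨hR l, hRa l, ?_⟩, ?_⟩
  · rw [← tsum_mul_left]
    exact (hs l).tsum_le_tsum (hle l) (h.1.mul_left 4)
  · ext x
    refine (h.2 x).unique ?_
    have h1 := hasSum_sum (s := Finset.univ) fun (l : Fin 4) _ =>
      ((hRa l).2 x).const_smul ((1 / 4 : ℂ) * Complex.I ^ (l : ℕ))
    simp only [ha, polarization_rankOne, hfg] at h1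
    simpa using h1

end Decomposition

section Sequences

lemma exists_subseq_cauchySeq {κ : Type*} [Countable κ] (z : κ → ℕ → ℂ) (M : κ → ℝ)
    (hM : ∀ k n, ‖z k n‖ ≤ M k) :
    ∃ φ : ℕ → ℕ, StrictMono φ ∧ ∀ k, CauchySeq fun n => z k (φ n) := by
  have hc : IsCompact (Set.univ.pi fun k => Metric.closedBall (0 : ℂ) (M k)) :=
    isCompact_univ_pi fun k => isCompact_closedBall _ _
  obtain ⟨w, -, φ, hφ, hw⟩ := hc.tendsto_subseq (x := fun n k => z k n) fun n => by
    simpa [Set.mem_pi] using fun k => hM k n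
  exact ⟨φ, hφ, fun k => (tendsto_pi_nhds.1 hw k).cauchySeq⟩

lemma cauchySeq_of_forall_approx {E : Type*} [SeminormedAddCommGroup E] {u : ℕ → E}
    (h : ∀ ε > 0, ∃ v : ℕ → E, CauchySeq v ∧ ∀ n, ‖u n - v n‖ ≤ ε) : CauchySeq u := by
  rw [Metric.cauchySeq_iff]
  intro ε hε
  obtain ⟨v, hv, huv⟩ := h (ε / 4) (by positivity)
  obtain ⟨N, hN⟩ := Metric.cauchySeq_iff.1 hv (ε / 4) (by positivity)
  refine ⟨N, fun m hm n hn => ?_⟩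
  have h1 := hN m hm n hn
  have h2 := huv m
  have h3 := huv n
  rw [← dist_eq_norm] at h2 h3
  have h4 := dist_triangle4 (u m) (v m) (v n) (u n)
  rw [dist_comm (v n)] at h4
  linarith

end Sequences

section DenseRange

variable {H : Type*} [NormedAddCommGroup H] [InnerProductSpace ℂ H]

lemma HilbertBasis.separableSpace {ι : Type*} [Countable ι] (e : HilbertBasis ι ℂ H) :
    TopologicalSpace.SeparableSpace H := by
  have h : TopologicalSpace.IsSeparable (Submodule.span ℂ (Set.range e) : Set H) :=
    (Set.countable_range e).isSeparable.span
  have h2 := h.closure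
  rw [← Submodule.topologicalClosure_coe, e.dense_span] at h2
  exact TopologicalSpace.isSeparable_univ_iff.1 h2

lemma denseRange_of_isPositive [CompleteSpace H] {σ : H →L[ℂ] H} (hσ : σ.IsPositive)
    (h0 : ∀ x, σ x = 0 → x = 0) : DenseRange σ := by
  have h : (LinearMap.range (σ : H →ₗ[ℂ] H)).topologicalClosure = ⊤ := by
    rw [Submodule.topologicalClosure_eq_top_iff, Submodule.eq_bot_iff]
    intro x hx
    apply h0
    rw [Submodule.mem_orthogonal] at hx
    have := hx (σ (σ x)) ⟨σ x, rfl⟩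
    rw [hσ.inner_left_eq_inner_right] at this
    exact inner_self_eq_zero.1 this
  have h2 := (Submodule.dense_iff_topologicalClosure_eq_top).2 h
  exact h2

end DenseRange

section TraceNorm

variable {H : Type*} [NormedAddCommGroup H] [InnerProductSpace ℂ H] [CompleteSpace H] {ι : Type*}
  {e : HilbertBasis ι ℂ H}

lemma tnConv_iff {A : ℕ → H →L[ℂ] H} {L : H →L[ℂ] H} (htc : ∀ n, IsTC (A n)) (hL : IsTC L) :
    TNConv e A L ↔ Tendsto (fun n => traceFun e (A n)) atTop (𝓝 (traceFun e L)) := by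
  rw [tendsto_iff_norm_sub_tendsto_zero, TNConv]
  simp only [tnorm_eq_norm_traceFun ((htc _).sub hL), traceFun_sub (htc _) hL]

lemma cauchySeq_of_cauchySeq_traceFun {A : ℕ → H →L[ℂ] H} (htc : ∀ n, IsTC (A n))
    (h : CauchySeq fun n => traceFun e (A n)) : CauchySeq A := by
  rw [Metric.cauchySeq_iff] at h ⊢
  intro ε hε
  obtain ⟨N, hN⟩ := h ε hε
  refine ⟨N, fun m hm n hn => lt_of_le_of_lt ?_ (hN m hm n hn)⟩
  rw [dist_eq_norm, dist_eq_norm, ← traceFun_sub (htc m) (htc n)]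
  exact norm_le_traceFun ((htc m).sub (htc n))

end TraceNorm

section PosMapLemmas

variable {HA HB : Type*} [NormedAddCommGroup HA] [InnerProductSpace ℂ HA]
  [NormedAddCommGroup HB] [InnerProductSpace ℂ HB]
  {eA : HilbertBasis ℕ ℂ HA} {eB : HilbertBasis ℕ ℂ HB}

namespace PosMap

variable (Φ : PosMap eA eB) {C : ℝ} {ρ ρ' : HA →L[ℂ] HA}

lemma map_zero : Φ.toFun 0 = 0 := by
  simpa using Φ.map_smul' 0 0 isTC_zero

lemma map_sub (h : IsTC ρ) (h' : IsTC ρ') : Φ.toFun (ρ - ρ') = Φ.toFun ρ - Φ.toFun ρ' := by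
  have h1 := Φ.map_add' ρ ((-1 : ℂ) • ρ') h (h'.smul _)
  rw [Φ.map_smul' _ _ h'] at h1
  simpa [sub_eq_add_neg] using h1

lemma map_sum {α : Type*} (s : Finset α) (c : α → ℂ) (R : α → HA →L[ℂ] HA)
    (h : ∀ i, IsTC (R i)) : Φ.toFun (∑ i ∈ s, c i • R i) = ∑ i ∈ s, c i • Φ.toFun (R i) := by
  classical
  induction s using Finset.induction_on with
  | empty => simpa using Φ.map_zero
  | insert i s hi ih =>
    rw [Finset.sum_insert hi, Finset.sum_insert hi, Φ.map_add' _ _ ((h i).smul _)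
      (isTC_sum _ _ fun j _ => (h j).smul _), Φ.map_smul' _ _ (h i), ih]

variable {Φ} [CompleteSpace HB]

lemma norm_traceFun_le_of_isPositive
    (hC : ∀ ρ, IsState eA ρ → tnorm eB (Φ.toFun ρ) ≤ C) {a : ℕ → HA} (hρ : ρ.IsPositive)
    (h : NuclearRep ρ a a) : ‖traceFun eB (Φ.toFun ρ)‖ ≤ C * ∑' n, ‖a n‖ ^ 2 := by
  have ht : traceFun eA ρ 1 = ((∑' n, ‖a n‖ ^ 2 : ℝ) : ℂ) := h.traceFun_one_self
  set t : ℝ := ∑' n, ‖a n‖ ^ 2 with htdef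
  have ht0 : 0 ≤ t := tsum_nonneg fun n => by positivity
  rcases ht0.eq_or_lt with h0 | h0
  · have ha : ∀ n, a n = 0 := fun n => by
      have h1 := (hasSum_zero_iff_of_nonneg (fun n => by positivity)).1
        (h0 ▸ h.summable_sq.hasSum : HasSum (fun n => ‖a n‖ ^ 2) 0)
      simpa using congrFun h1 n
    have hρ0 : ρ = 0 := by
      ext x
      refine (h.2 x).unique ?_
      simp [ha]
    have h2 : traceFun eB (0 : HB →L[ℂ] HB) = 0 := by
      simpa using traceFun_sub (e := eB) (isTC_zero (H := HB)) isTC_zero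
    rw [hρ0, Φ.map_zero, h2, ← h0]
    simp
  · have htC : (t : ℂ) ≠ 0 := by exact_mod_cast h0.ne'
    have hst : IsState eA (((t⁻¹ : ℝ) : ℂ) • ρ) := by
      refine ⟨hρ.smul_of_nonneg ?_, h.isTC.smul _, ?_⟩
      · exact_mod_cast (inv_pos.2 h0).le
      · rw [← traceFun_one (h.isTC.smul _), traceFun_smul h.isTC, _root_.smul_apply, ht]
        simp [htC]
    have h1 := hC _ hst
    rw [tnorm_eq_norm_traceFun (Φ.maps_tc' _ (h.isTC.smul _)), Φ.map_smul' _ _ h.isTC,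
      traceFun_smul (Φ.maps_tc' _ h.isTC), norm_smul, Complex.norm_real,
      Real.norm_of_nonneg (inv_pos.2 h0).le, inv_mul_le_iff₀ h0] at h1
    linarith

variable [CompleteSpace HA]

lemma norm_traceFun_le (hC0 : 0 ≤ C)
    (hC : ∀ ρ, IsState eA ρ → tnorm eB (Φ.toFun ρ) ≤ C) {f g : ℕ → HA}
    (h : NuclearRep ρ f g) : ‖traceFun eB (Φ.toFun ρ)‖ ≤ 4 * C * ∑' n, ‖f n‖ * ‖g n‖ := by
  obtain ⟨R, a, hR, rfl⟩ := h.exists_positive_decomposition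
  have htc : ∀ l, IsTC (R l) := fun l => (hR l).2.1.isTC
  have h1 : traceFun eB (Φ.toFun (∑ l : Fin 4, ((1 / 4 : ℂ) * Complex.I ^ (l : ℕ)) • R l)) =
      ∑ l : Fin 4, ((1 / 4 : ℂ) * Complex.I ^ (l : ℕ)) • traceFun eB (Φ.toFun (R l)) := by
    rw [Φ.map_sum _ _ _ htc]
    simp only [Fin.sum_univ_four]
    have h2 := fun l => Φ.maps_tc' _ (htc l)
    rw [traceFun_add ((((h2 _).smul _).add ((h2 _).smul _)).add ((h2 _).smul _)) ((h2 _).smul _),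
      traceFun_add (((h2 _).smul _).add ((h2 _).smul _)) ((h2 _).smul _),
      traceFun_add ((h2 _).smul _) ((h2 _).smul _)]
    simp only [traceFun_smul (h2 _)]
  rw [h1]
  refine (norm_sum_le _ _).trans ?_
  have h3 : ∀ l ∈ Finset.univ, ‖((1 / 4 : ℂ) * Complex.I ^ ((l : Fin 4) : ℕ)) •
      traceFun eB (Φ.toFun (R l))‖ ≤ C * ∑' n, ‖f n‖ * ‖g n‖ := fun l _ => by
    rw [norm_smul]
    have h4 : ‖(1 / 4 : ℂ) * Complex.I ^ (l : ℕ)‖ = 1 / 4 := by simp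
    have h5 := norm_traceFun_le_of_isPositive hC (hR l).1 (hR l).2.1
    have h6 := mul_le_mul_of_nonneg_left (hR l).2.2 hC0
    rw [h4]
    linarith
  refine (Finset.sum_le_sum h3).trans_eq ?_
  simp
  ring

lemma norm_traceFun_rankOne_le (hC0 : 0 ≤ C)
    (hC : ∀ ρ, IsState eA ρ → tnorm eB (Φ.toFun ρ) ≤ C) (y z : HA) :
    ‖traceFun eB (Φ.toFun (rankOne y z))‖ ≤ 4 * C * (‖y‖ * ‖z‖) := by
  have h := norm_traceFun_le hC0 hC (nuclearRep_rankOne y z)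
  rwa [tsum_eq_single 0 fun n hn => by simp [hn], if_pos rfl] at h

end PosMap

variable [CompleteSpace HA] [CompleteSpace HB] {Φ : ℕ → PosMap eA eB} {C : ℝ}

/-- Trace-norm Cauchyness on rank-one projectors over a dense set extends to all trace-class
operators, for a uniformly bounded sequence of positive maps. -/
lemma cauchySeq_traceFun_of_dense (hC0 : 0 ≤ C)
    (hC : ∀ n ρ, IsState eA ρ → tnorm eB ((Φ n).toFun ρ) ≤ C) {D : Set HA} (hD : Dense D)
    (h : ∀ d ∈ D, CauchySeq fun n => traceFun eB ((Φ n).toFun (rankOne d d)))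
    {ρ : HA →L[ℂ] HA} (hρ : IsTC ρ) : CauchySeq fun n => traceFun eB ((Φ n).toFun ρ) := by
  have hsub : ∀ {ρ ρ' : HA →L[ℂ] HA}, IsTC ρ → IsTC ρ' → ∀ n,
      traceFun eB ((Φ n).toFun (ρ - ρ')) =
        traceFun eB ((Φ n).toFun ρ) - traceFun eB ((Φ n).toFun ρ') := fun h h' n => by
    rw [(Φ n).map_sub h h', traceFun_sub ((Φ n).maps_tc' _ h) ((Φ n).maps_tc' _ h')]
  have hadd : ∀ {ρ ρ' : HA →L[ℂ] HA}, IsTC ρ → IsTC ρ' → ∀ n,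
      traceFun eB ((Φ n).toFun (ρ + ρ')) =
        traceFun eB ((Φ n).toFun ρ) + traceFun eB ((Φ n).toFun ρ') := fun h h' n => by
    rw [(Φ n).map_add' _ _ h h', traceFun_add ((Φ n).maps_tc' _ h) ((Φ n).maps_tc' _ h')]
  have hsmul : ∀ {ρ : HA →L[ℂ] HA} (c : ℂ), IsTC ρ → ∀ n,
      traceFun eB ((Φ n).toFun (c • ρ)) = c • traceFun eB ((Φ n).toFun ρ) := fun c h n => by
    rw [(Φ n).map_smul' _ _ h, traceFun_smul ((Φ n).maps_tc' _ h)]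
  have hproj : ∀ x, CauchySeq fun n => traceFun eB ((Φ n).toFun (rankOne x x)) := by
    intro x
    refine cauchySeq_of_forall_approx fun ε hε => ?_
    have hcont : Continuous fun d : HA => 4 * C * (‖x - d‖ * ‖x‖) + 4 * C * (‖d‖ * ‖x - d‖) := by
      fun_prop
    have hnear := (hcont.tendsto x).eventually (gt_mem_nhds (by simpa using hε))
    obtain ⟨d, hd, hdD⟩ := mem_closure_iff_nhds.1 (hD x) _ hnear
    refine ⟨_, h d hdD, fun n => le_trans ?_ (le_of_lt hd)⟩
    rw [← hsub (isTC_rankOne _ _) (isTC_rankOne _ _)]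
    have hsplit : rankOne x x - rankOne d d = rankOne (x - d) x + rankOne d (x - d) := by
      ext y
      simp only [_root_.sub_apply, _root_.add_apply, rankOne_apply, inner_sub_left]
      module
    rw [hsplit, hadd (isTC_rankOne _ _) (isTC_rankOne _ _)]
    exact (norm_add_le _ _).trans (add_le_add (PosMap.norm_traceFun_rankOne_le hC0 (hC n) _ _)
      (PosMap.norm_traceFun_rankOne_le hC0 (hC n) _ _))
  have hone : ∀ y z, CauchySeq fun n => traceFun eB ((Φ n).toFun (rankOne y z)) := by
    intro y z
    have hpol : rankOne y z = ∑ l : Fin 4, ((1 / 4 : ℂ) * Complex.I ^ (l : ℕ)) •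
        rankOne (y + Complex.I ^ (l : ℕ) • z) (y + Complex.I ^ (l : ℕ) • z) := by
      ext x
      simp only [_root_.sum_apply, _root_.smul_apply, rankOne_apply, polarization_rankOne]
    have ht := fun (l : Fin 4) => isTC_rankOne (y + Complex.I ^ (l : ℕ) • z)
      (y + Complex.I ^ (l : ℕ) • z)
    have hs := fun (l : Fin 4) => (ht l).smul ((1 / 4 : ℂ) * Complex.I ^ (l : ℕ))
    have hc := fun (l : Fin 4) => (uniformContinuous_const_smul
      ((1 / 4 : ℂ) * Complex.I ^ (l : ℕ))).comp_cauchySeq (hproj (y + Complex.I ^ (l : ℕ) • z))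
    rw [hpol]
    simp only [Fin.sum_univ_four, hadd (((hs 0).add (hs 1)).add (hs 2)) (hs 3),
      hadd ((hs 0).add (hs 1)) (hs 2), hadd (hs 0) (hs 1), hsmul _ (ht _)]
    exact (((hc 0).add (hc 1)).add (hc 2)).add (hc 3)
  obtain ⟨f, g, hfg⟩ := hρ.exists_nuclearRep
  have hsum : ∀ N, CauchySeq fun n =>
      traceFun eB ((Φ n).toFun (∑ k ∈ Finset.range N, rankOne (f k) (g k))) := by
    intro N
    induction N with
    | zero =>
      simp only [Finset.range_zero, Finset.sum_empty, PosMap.map_zero]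
      exact cauchySeq_const _
    | succ N ih =>
      simp only [Finset.sum_range_succ, hadd (isTC_sum _ _ fun k _ => isTC_rankOne _ _)
        (isTC_rankOne _ _)]
      exact ih.add (hone _ _)
  refine cauchySeq_of_forall_approx fun ε hε => ?_
  have htail := (tendsto_sum_nat_add fun n => ‖f n‖ * ‖g n‖).const_mul (4 * C)
  rw [mul_zero] at htail
  obtain ⟨N, hN⟩ := (htail.eventually (gt_mem_nhds hε)).exists
  refine ⟨_, hsum N, fun n => ?_⟩
  rw [← hsub hρ (isTC_sum _ _ fun k _ => isTC_rankOne _ _)]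
  exact (PosMap.norm_traceFun_le hC0 (hC n) (hfg.sub_sum N)).trans hN.le

/-- If `Φ n σ` converges in the trace norm, then `Φ n (|σ y⟩⟨σ y|)`, which is dominated by a
multiple of `Φ n σ`, is Cauchy in the trace norm as soon as its matrix elements are Cauchy. -/
lemma cauchySeq_traceFun_of_dominated
    {σ : HA →L[ℂ] HA} (hσ : σ.IsPositive) (hσtc : IsTC σ) {L : HB →L[ℂ] HB} (hL : IsTC L)
    (hlim : Tendsto (fun n => traceFun eB ((Φ n).toFun σ)) atTop (𝓝 (traceFun eB L)))
    (hC0 : 0 ≤ C) (hC : ∀ n ρ, IsState eA ρ → tnorm eB ((Φ n).toFun ρ) ≤ C) (y : HA)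
    (hmat : ∀ i j, CauchySeq fun n => ⟪eB i, (Φ n).toFun (rankOne (σ y) (σ y)) (eB j)⟫) :
    CauchySeq fun n => traceFun eB ((Φ n).toFun (rankOne (σ y) (σ y))) := by
  have htc : IsTC (rankOne (σ y) (σ y)) := isTC_rankOne _ _
  have hpos : (rankOne (σ y) (σ y)).IsPositive := isPositive_iff_inner_nonneg.2 fun x => by
    rw [rankOne_apply, inner_smul_right, ← inner_conj_symm, Complex.conj_mul']
    exact_mod_cast sq_nonneg ‖⟪x, σ y⟫‖
  have hCn := fun n => PosMap.norm_traceFun_rankOne_le hC0 (hC n) (σ y) (σ y)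
  refine cauchySeq_traceFun_of_tails (fun n => (Φ n).pos' _ hpos htc)
    (fun n => (Φ n).maps_tc' _ htc) hCn hmat fun ε hε => ?_
  set c : ℝ := (⟪y, σ y⟫).re with hc
  have hdom : ((c : ℂ) • σ - rankOne (σ y) (σ y)).IsPositive := by
    refine isPositive_iff_inner_nonneg.2 fun x => ?_
    have h1 := norm_inner_sq_le_of_isPositive hσ x y
    have h2 := isPositive_iff_inner_nonneg.1 hσ x
    have h3 : ⟪x, σ x⟫ = ((⟪x, σ x⟫).re : ℂ) := Complex.ext rfl h2.2.symm
    rw [_root_.sub_apply, _root_.smul_apply, rankOne_apply, inner_sub_right, inner_smul_right,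
      inner_smul_right, ← inner_conj_symm (σ y) x, Complex.conj_mul', h3]
    have h4 : 0 ≤ c * (⟪x, σ x⟫).re - ‖⟪x, σ y⟫‖ ^ 2 := by linarith
    exact_mod_cast h4
  have hbd : ∀ n s, (traceFun eB ((Φ n).toFun (rankOne (σ y) (σ y))) (1 - finProj eB s)).re ≤
      c * (traceFun eB ((Φ n).toFun σ) (1 - finProj eB s)).re := by
    intro n s
    have htc' := (hσtc.smul (c : ℂ)).sub htc
    have h1 := traceFun_one_sub_finProj_nonneg (e := eB) ((Φ n).pos' _ hdom htc')
      ((Φ n).maps_tc' _ htc') s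
    rw [(Φ n).map_sub (hσtc.smul _) htc, (Φ n).map_smul' _ _ hσtc,
      traceFun_sub (((Φ n).maps_tc' _ hσtc).smul _) ((Φ n).maps_tc' _ htc),
      traceFun_smul ((Φ n).maps_tc' _ hσtc), _root_.sub_apply, _root_.smul_apply, smul_eq_mul,
      Complex.sub_re, Complex.re_ofReal_mul] at h1
    linarith
  have h1 : Tendsto (fun s => c * (traceFun eB L (1 - finProj eB s)).re) atTop (𝓝 0) := by
    simpa using ((Complex.continuous_re.tendsto _).comp
      (tendsto_traceFun_one_sub_finProj (e := eB) hL)).const_mul c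
  obtain ⟨s, hs⟩ := (h1.eventually (gt_mem_nhds hε)).exists
  have h2 : Tendsto (fun n => c * (traceFun eB ((Φ n).toFun σ) (1 - finProj eB s)).re) atTop
      (𝓝 (c * (traceFun eB L (1 - finProj eB s)).re)) := by
    refine Tendsto.const_mul c ((Complex.continuous_re.tendsto _).comp ?_)
    exact ((ContinuousLinearMap.apply ℂ ℂ (1 - finProj eB s)).continuous.tendsto _).comp hlim
  exact ⟨s, (h2.eventually (gt_mem_nhds hs)).mono fun n hn => (hbd n s).trans hn.le⟩

/-- A uniformly bounded sequence of positive maps which is pointwise Cauchy in the trace norm has a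
strong limit. -/
lemma exists_pStrongConv_of_cauchySeq (hC0 : 0 ≤ C)
    (hC : ∀ n ρ, IsState eA ρ → tnorm eB ((Φ n).toFun ρ) ≤ C)
    (h : ∀ ρ, IsTC ρ → CauchySeq fun n => traceFun eB ((Φ n).toFun ρ)) :
    ∃ Φ₀ : PosMap eA eB, PStrongConv Φ Φ₀ := by
  have hcauchy : ∀ ρ, IsTC ρ → CauchySeq fun n => (Φ n).toFun ρ := fun ρ hρ =>
    cauchySeq_of_cauchySeq_traceFun (fun n => (Φ n).maps_tc' ρ hρ) (h ρ hρ)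
  set T : (HA →L[ℂ] HA) → (HB →L[ℂ] HB) := fun ρ => limUnder atTop fun n => (Φ n).toFun ρ
  have hT : ∀ ρ, IsTC ρ → Tendsto (fun n => (Φ n).toFun ρ) atTop (𝓝 (T ρ)) :=
    fun ρ hρ => (hcauchy ρ hρ).tendsto_limUnder
  have hadd : ∀ ρ ρ', IsTC ρ → IsTC ρ' → T (ρ + ρ') = T ρ + T ρ' := fun ρ ρ' hρ hρ' => by
    refine tendsto_nhds_unique (hT _ (hρ.add hρ')) ?_
    simpa only [(Φ _).map_add' _ _ hρ hρ'] using (hT _ hρ).add (hT _ hρ')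
  have hsmul : ∀ (c : ℂ) ρ, IsTC ρ → T (c • ρ) = c • T ρ := fun c ρ hρ => by
    refine tendsto_nhds_unique (hT _ (hρ.smul c)) ?_
    simpa only [(Φ _).map_smul' _ _ hρ] using (hT _ hρ).const_smul c
  have hpos : ∀ ρ, ρ.IsPositive → IsTC ρ → (T ρ).IsPositive := fun ρ hρ hρtc =>
    isPositive_of_tendsto (fun n => (Φ n).pos' ρ hρ hρtc) (hT ρ hρtc)
  have htcpos : ∀ ρ, ρ.IsPositive → IsTC ρ → IsTC (T ρ) := by
    intro ρ hρ hρtc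
    obtain ⟨f, g, hfg⟩ := hρtc.exists_nuclearRep
    obtain ⟨a, ha⟩ := exists_nuclearRep_of_isPositive eB (hpos ρ hρ hρtc)
      (C := 4 * C * ∑' n, ‖f n‖ * ‖g n‖) fun s => by
        have ht : Tendsto (fun n => ‖∑ i ∈ s, ⟪eB i, (Φ n).toFun ρ (eB i)⟫‖) atTop
            (𝓝 ‖∑ i ∈ s, ⟪eB i, T ρ (eB i)⟫‖) :=
          (tendsto_finsetSum _ fun i _ => tendsto_const_nhds.inner
            (((ContinuousLinearMap.apply ℂ HB (eB i)).continuous.tendsto _).comp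
              (hT ρ hρtc))).norm
        exact le_of_tendsto' ht fun n => (norm_sum_diag_le ((Φ n).maps_tc' _ hρtc) s).trans
          (PosMap.norm_traceFun_le hC0 (hC n) hfg)
    exact ha.isTC
  have htc : ∀ ρ, IsTC ρ → IsTC (T ρ) := by
    intro ρ hρ
    obtain ⟨f, g, hfg⟩ := hρ.exists_nuclearRep
    obtain ⟨R, a, hR, rfl⟩ := hfg.exists_positive_decomposition
    have ht := fun l => (hR l).2.1.isTC
    have hs := fun (l : Fin 4) => (ht l).smul ((1 / 4 : ℂ) * Complex.I ^ (l : ℕ))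
    have hTs := fun (l : Fin 4) =>
      (htcpos (R l) (hR l).1 (ht l)).smul ((1 / 4 : ℂ) * Complex.I ^ (l : ℕ))
    rw [Fin.sum_univ_four, hadd _ _ (((hs 0).add (hs 1)).add (hs 2)) (hs 3),
      hadd _ _ ((hs 0).add (hs 1)) (hs 2), hadd _ _ (hs 0) (hs 1), hsmul _ _ (ht _),
      hsmul _ _ (ht _), hsmul _ _ (ht _), hsmul _ _ (ht _)]
    exact (((hTs 0).add (hTs 1)).add (hTs 2)).add (hTs 3)
  have hlim : ∀ ρ, IsTC ρ →
      Tendsto (fun n => traceFun eB ((Φ n).toFun ρ)) atTop (𝓝 (traceFun eB (T ρ))) :=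
    fun ρ hρ => tendsto_traceFun_of_cauchySeq (fun n => (Φ n).maps_tc' ρ hρ) (h ρ hρ) (hT ρ hρ)
      (htc ρ hρ)
  refine ⟨⟨T, hadd, hsmul, htc, hpos, C, fun ρ hρ => ?_⟩, fun ρ hρ => ?_⟩
  · rw [tnorm_eq_norm_traceFun (htc ρ hρ.2.1)]
    refine le_of_tendsto' (hlim ρ hρ.2.1).norm fun n => ?_
    rw [← tnorm_eq_norm_traceFun ((Φ n).maps_tc' ρ hρ.2.1)]
    exact hC n ρ hρ
  · exact (tnConv_iff (fun n => (Φ n).maps_tc' ρ hρ.2.1) (htc ρ hρ.2.1)).2 (hlim ρ hρ.2.1)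

end PosMapLemmas

/-- The compactness criterion for subsets of positive linear maps between the spaces of
trace-class operators, in the strong convergence topology: (A) a closed bounded subset `L₀`
is compact if `{Φ(σ) : Φ ∈ L₀}` is trace-norm compact for some faithful state `σ`;
(B) if `L₀` is compact then `{Φ(σ) : Φ ∈ L₀}` is trace-norm compact for every state `σ`. -/
theorem positive_maps_compactness_criterion
    (eA : HilbertBasis ℕ ℂ HA) (eB : HilbertBasis ℕ ℂ HB)
    (L₀ : Set (PosMap eA eB)) :
    ((PSeqClosed L₀ ∧ (∃ C : ℝ, ∀ Φ ∈ L₀, ∀ ρ : HA →L[ℂ] HA, IsState eA ρ →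
        tnorm eB (Φ.toFun ρ) ≤ C) ∧
      ∃ σ : HA →L[ℂ] HA, IsFaithfulState eA σ ∧
        TNSeqCompact eB {x | ∃ Φ ∈ L₀, x = Φ.toFun σ}) →
      PSeqCompact L₀) ∧
    (PSeqCompact L₀ → ∀ σ : HA →L[ℂ] HA, IsState eA σ →
      TNSeqCompact eB {x | ∃ Φ ∈ L₀, x = Φ.toFun σ}) := by
  refine ⟨fun ⟨hclosed, ⟨C, hC⟩, σ, hσ, hcpt⟩ Φ hΦ => ?_, fun h σ hσ a ha => ?_⟩
  · obtain ⟨k, _, hk, ⟨Ψ, -, rfl⟩, hlim⟩ := hcpt (fun n => (Φ n).toFun σ) fun n => ⟨Φ n, hΦ n, rfl⟩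
    have hσtc : IsTC σ := hσ.1.2.1
    have hΨ := Ψ.maps_tc' σ hσtc
    have hC0 : 0 ≤ C := by
      refine le_trans ?_ (hC _ (hΦ 0) σ hσ.1)
      rw [tnorm_eq_norm_traceFun ((Φ 0).maps_tc' σ hσtc)]
      exact norm_nonneg _
    have := eA.separableSpace
    let d : ℕ → HA := fun m => σ (TopologicalSpace.denseSeq HA m)
    have hd : DenseRange d := (denseRange_of_isPositive hσ.1.1 hσ.2).comp
      (TopologicalSpace.denseRange_denseSeq HA) σ.continuous
    obtain ⟨l, hl, hmat⟩ := exists_subseq_cauchySeq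
      (fun (p : ℕ × ℕ × ℕ) n => ⟪eB p.2.1, (Φ (k n)).toFun (rankOne (d p.1) (d p.1)) (eB p.2.2)⟫)
      (fun p => 4 * C * (‖d p.1‖ * ‖d p.1‖)) fun p n => by
        have h1 := norm_inner_le_traceFun (e := eB)
          ((Φ (k n)).maps_tc' _ (isTC_rankOne (d p.1) (d p.1))) (eB p.2.1) (eB p.2.2)
        rw [eB.orthonormal.norm_eq_one, eB.orthonormal.norm_eq_one, mul_one, mul_one] at h1
        exact h1.trans (PosMap.norm_traceFun_rankOne_le hC0 (hC _ (hΦ _)) _ _)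
    have hCl : ∀ n ρ, IsState eA ρ → tnorm eB ((Φ (k (l n))).toFun ρ) ≤ C :=
      fun n => hC _ (hΦ _)
    rw [tnConv_iff (fun n => (Φ (k n)).maps_tc' σ hσtc) hΨ] at hlim
    have hdense : ∀ x ∈ Set.range d,
        CauchySeq fun n => traceFun eB ((Φ (k (l n))).toFun (rankOne x x)) := by
      rintro _ ⟨m, rfl⟩
      exact cauchySeq_traceFun_of_dominated hσ.1.1 hσtc hΨ (hlim.comp hl.tendsto_atTop) hC0 hCl _
        fun i j => hmat (m, i, j)
    obtain ⟨Φ₀, hΦ₀⟩ := exists_pStrongConv_of_cauchySeq hC0 hCl fun ρ hρ =>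
      cauchySeq_traceFun_of_dense hC0 hCl hd hdense hρ
    exact ⟨k ∘ l, Φ₀, hk.comp hl, hclosed _ _ (fun n => hΦ _) hΦ₀, hΦ₀⟩
  · choose Φ hΦ ha using ha
    obtain ⟨k, Φ₀, hk, hΦ₀, hlim⟩ := h Φ hΦ
    refine ⟨k, Φ₀.toFun σ, hk, ⟨Φ₀, hΦ₀, rfl⟩, ?_⟩
    simpa only [ha] using hlim σ hσ

end Statement
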